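/- Let K be a number field with ring of integers O_K which is a principal ideal domain, let k ⊆ K be a subfield with K/k of degree 2 and Galois with involution ι, and let O_k = O_K ∩ k. Suppose b ∈ O_K has square-free absolute norm |N_{K/ℚ}(b)|. If a ∈ k can be written as a = c/d with c, d ∈ O_K relatively prime and d dividing b, then d is a unit and a ∈ O_k. -/

import Mathlib

open NumberField

/-- An integer of `K` whose value lies in the subfield `k` comes from an integer of `k`. -/
theorem exists_algebraMap_eq_of_coe_mem {K : Type*} [Field K] [NumberField K] (k : Subfield K)
    (z : 𝓞 K) (hz : (z : K) ∈ k) : ∃ x : 𝓞 k, algebraMap (𝓞 k) (𝓞 K) x = z := by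
  have hint : IsIntegral ℤ (⟨z, hz⟩ : k) := by
    refine (isIntegral_algHom_iff ((algebraMap k K).toIntAlgHom) (algebraMap k K).injective).mp ?_
    exact z.isIntegral_coe
  exact ⟨⟨⟨z, hz⟩, hint⟩, RingOfIntegers.ext rfl⟩

/-- A principal ideal extended from a proper subfield, whose generator has square-free norm,
is the unit ideal. -/
theorem isUnit_of_span_eq_map {K : Type*} [Field K] [NumberField K] (k : Subfield K)
    (hk : k ≠ ⊤) (d : 𝓞 K) (hd : Squarefree (Algebra.norm ℤ d)) (J : Ideal (𝓞 k))
    (hJ : J.map (algebraMap (𝓞 k) (𝓞 K)) = Ideal.span {d}) : IsUnit d := by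
  have hrank : 2 ≤ Module.finrank (𝓞 k) (𝓞 K) := by
    rw [← IsFractionRing.finrank_eq (𝓞 k) k (𝓞 K) K]
    have hpos : 0 < Module.finrank k K := Module.finrank_pos
    have hone : Module.finrank k K ≠ 1 := fun h ↦ hk <| by
      rw [eq_top_iff]
      intro z _
      obtain ⟨y, rfl⟩ := (Algebra.finrank_eq_one_iff_bijective_algebraMap.mp h).2 z
      exact y.2
    omega
  have hnorm := Ideal.absNorm_algebraMap (𝓞 k) (𝓞 K) J
  rw [hJ, Ideal.absNorm_span_singleton] at hnorm
  have hsq := Int.squarefree_natAbs.mpr hd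
  have hunit : IsUnit (Ideal.absNorm J) := by
    refine hsq _ ?_
    rw [hnorm, ← pow_two]
    exact pow_dvd_pow _ hrank
  rw [Nat.isUnit_iff, Ideal.absNorm_eq_one_iff] at hunit
  rw [← Ideal.span_singleton_eq_top, ← hJ, hunit, Ideal.map_top]

/-- Let `K` be a number field whose ring of integers `O_K` is a PID,
`k ⊆ K` a subfield such that `K/k` is Galois of degree `2` with nontrivial involution `ι`
(encoded by: `ι ∘ ι = id`, `ι ≠ id` and the fixed field of `ι` is exactly `k`), and let
`b ∈ O_K` have square-free absolute norm.  If `a ∈ k` can be written as `a = c/d` with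
`c, d ∈ O_K` relatively prime and `d ∣ b`, then `d` is a unit and `a ∈ O_k = O_K ∩ k`
(i.e. `a` is an algebraic integer). -/
theorem stmt4 (K : Type*) [Field K] [NumberField K]
    (hPID : IsPrincipalIdealRing (𝓞 K))
    (k : Subfield K) (ι : K ≃+* K)
    (hinv : ι.trans ι = RingEquiv.refl K)
    (hne : ι ≠ RingEquiv.refl K)
    (hfix : ∀ z : K, ι z = z ↔ z ∈ k)
    (b : 𝓞 K) (hb : Squarefree (Algebra.norm ℤ b))
    (a : K) (ha : a ∈ k)
    (c d : 𝓞 K) (hcd : IsCoprime c d)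
    (hacd : a = (c : K) / (d : K))
    (hdb : d ∣ b) :
    IsUnit d ∧ IsIntegral ℤ a := by
  have hd0 : d ≠ 0 := by
    rintro rfl
    rw [zero_dvd_iff] at hdb
    subst hdb
    simp at hb
  have hd0' : (d : K) ≠ 0 := RingOfIntegers.coe_ne_zero_iff.mpr hd0
  have hk : k ≠ ⊤ := by
    rintro rfl
    exact hne (RingEquiv.ext fun z ↦ (hfix z).mpr trivial)
  have hιι (z : K) : ι (ι z) = z := RingEquiv.congr_fun hinv z
  let σ : 𝓞 K ≃+* 𝓞 K := RingOfIntegers.mapRingEquiv ι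
  have hσ (z : 𝓞 K) : ((σ z : 𝓞 K) : K) = ι z := rfl
  have hmul (z w : 𝓞 K) : ((z * w : 𝓞 K) : K) = z * w := rfl
  have hcross : (c : K) * ι d = d * ι c := by
    have h := (hfix a).mpr ha
    rw [hacd, map_div₀, div_eq_div_iff ((map_ne_zero ι).mpr hd0') hd0'] at h
    linear_combination -h
  obtain ⟨x, hx⟩ := exists_algebraMap_eq_of_coe_mem k (d * σ c) <| by
    rw [← hfix, hmul, map_mul, hσ, hιι, mul_comm, hcross]
  obtain ⟨y, hy⟩ := exists_algebraMap_eq_of_coe_mem k (d * σ d) <| by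
    rw [← hfix, hmul, map_mul, hσ, hιι, mul_comm]
  have hJ : (Ideal.span {x, y}).map (algebraMap (𝓞 k) (𝓞 K)) = Ideal.span {d} := by
    rw [Ideal.map_span, Set.image_pair, hx, hy]
    apply le_antisymm
    · rw [Ideal.span_le]
      rintro z (rfl | rfl) <;>
        exact Ideal.mem_span_singleton.mpr (dvd_mul_right _ _)
    · rw [Ideal.span_singleton_le_iff_mem, Ideal.mem_span_pair]
      obtain ⟨u, v, huv⟩ := hcd.map (σ : 𝓞 K →+* 𝓞 K)
      refine ⟨u, v, ?_⟩
      simp only [RingEquiv.coe_toRingHom] at huv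
      linear_combination d * huv
  have hd : IsUnit d :=
    isUnit_of_span_eq_map k hk d (hb.squarefree_of_dvd (map_dvd _ hdb)) _ hJ
  refine ⟨hd, ?_⟩
  obtain ⟨e, he⟩ := hd.exists_right_inv
  have he' : (d : K) * e = 1 := by rw [← map_mul, he, map_one]
  have hace : a = ((c * e : 𝓞 K) : K) := by
    rw [hacd, div_eq_iff hd0', hmul]
    linear_combination -(c : K) * he'
  rw [hace]
  exact RingOfIntegers.isIntegral_coe _
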